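/- Let f : [a,b] → ℝ be the affine fractal function defined by a system S = {S₁,...,S_m} of affine maps S_i(x,y) = (p_i x + h_i, q_i y + r_i x + s_i) with 0 < |p_i| < 1 and 0 < |q_i| < 1. Let g = g_j⁻¹ ∘ g_i be an element of the associated family F, where g_i, g_j are elements of the semigroup G generated by S (each p-coefficient nonzero and each q-coefficient nonzero, so g_j is invertible), and let g^◊ = (g_j^◊)⁻¹ ∘ g_i^◊ be the corresponding element of F^◊. If x ∈ [a,b] and g^◊(x) ∈ [a,b], then g(x, f(x)) = (g^◊(x), f(g^◊(x))). -/

import Mathlib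

open Set

/-- An affine map of the plane of the form
`(x, y) ↦ (p·x + h, q·y + r·x + s)`, recorded by its coefficients. -/
structure Aff2 where
  p : ℝ
  h : ℝ
  q : ℝ
  r : ℝ
  s : ℝ

/-- The map of the plane determined by the coefficients. -/
def Aff2.toFun (g : Aff2) : ℝ × ℝ → ℝ × ℝ :=
  fun pt => (g.p * pt.1 + g.h, g.q * pt.2 + g.r * pt.1 + g.s)

/-- Composition `c ∘ d` at the level of coefficients. -/
def Aff2.comp (c d : Aff2) : Aff2 :=
  ⟨c.p * d.p, c.p * d.h + c.h, c.q * d.q, c.q * d.r + c.r * d.p,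
    c.q * d.s + c.r * d.h + c.s⟩

/-- Coefficients of the composition `S_{i₁} ∘ ⋯ ∘ S_{i_k}` for a word
`w = [i₁, …, i_k]`; nonempty words enumerate the semigroup `G` generated by `S`. -/
def wordCoeff {m : ℕ} (S : Fin m → Aff2) : List (Fin m) → Aff2
  | [] => ⟨1, 0, 1, 0, 0⟩
  | i :: w => (S i).comp (wordCoeff S w)

theorem Aff2.toFun_comp (c d : Aff2) (pt : ℝ × ℝ) :
    (c.comp d).toFun pt = c.toFun (d.toFun pt) := by
  ext <;> simp only [Aff2.toFun, Aff2.comp] <;> ring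

theorem wordCoeff_q_ne_zero {m : ℕ} {S : Fin m → Aff2} (hq : ∀ i, (S i).q ≠ 0)
    (w : List (Fin m)) : (wordCoeff S w).q ≠ 0 := by
  induction w with
  | nil => exact one_ne_zero
  | cons i w ih => exact mul_ne_zero (hq i) ih

theorem wordCoeff_mapsTo {m : ℕ} {S : Fin m → Aff2} {K : Set (ℝ × ℝ)}
    (hK : ∀ i, MapsTo (S i).toFun K K) (w : List (Fin m)) :
    MapsTo (wordCoeff S w).toFun K K := by
  induction w with
  | nil => intro pt hpt; simpa [wordCoeff, Aff2.toFun] using hpt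
  | cons i w ih =>
    intro pt hpt
    rw [wordCoeff, Aff2.toFun_comp]
    exact hK i (ih hpt)

/-- **Lemma 4.** Let `f` be the affine fractal function on `[a,b]` defined by a system
`S` with `0 < |pᵢ| < 1`, `0 < |qᵢ| < 1`.  If `g = g_v⁻¹ ∘ g_u` belongs to the
associated family `F = G⁻¹ ∘ G` (i.e. `g_v ∘ g = g_u` for nonempty words `u, v`), and
`x ∈ [a,b]`, `g^◊(x) = g.p·x + g.h ∈ [a,b]`, then
`g(x, f(x)) = (g^◊(x), f(g^◊(x)))`: the maps of `F` move points of the graph along the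
graph. -/
theorem assoc_family_moves_along_graph {m : ℕ} (a b : ℝ) (hab : a < b)
    (S : Fin m → Aff2)
    (hp : ∀ i, 0 < |(S i).p| ∧ |(S i).p| < 1)
    (hq : ∀ i, 0 < |(S i).q| ∧ |(S i).q| < 1)
    (f : ℝ → ℝ)
    (hcompact : IsCompact {pt : ℝ × ℝ | ∃ x ∈ Icc a b, pt = (x, f x)})
    (hattr : {pt : ℝ × ℝ | ∃ x ∈ Icc a b, pt = (x, f x)} =
      ⋃ i : Fin m, (S i).toFun '' {pt : ℝ × ℝ | ∃ x ∈ Icc a b, pt = (x, f x)})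
    (g : Aff2) (u v : List (Fin m)) (hu : u ≠ []) (hv : v ≠ [])
    (hgF : (wordCoeff S v).comp g = wordCoeff S u)
    (x : ℝ) (hx : x ∈ Icc a b) (hgx : g.p * x + g.h ∈ Icc a b) :
    g.toFun (x, f x) = (g.p * x + g.h, f (g.p * x + g.h)) := by
  have hK : ∀ i, MapsTo (S i).toFun {pt : ℝ × ℝ | ∃ x ∈ Icc a b, pt = (x, f x)}
      {pt : ℝ × ℝ | ∃ x ∈ Icc a b, pt = (x, f x)} := by
    intro i pt hpt
    rw [hattr]
    exact mem_iUnion.2 ⟨i, mem_image_of_mem _ hpt⟩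
  obtain ⟨c, -, hc⟩ := wordCoeff_mapsTo hK u ⟨x, hx, rfl⟩
  obtain ⟨d, -, hd⟩ := wordCoeff_mapsTo hK v ⟨g.p * x + g.h, hgx, rfl⟩
  rw [← hgF, Aff2.toFun_comp] at hc
  obtain ⟨hc₁, hc₂⟩ := Prod.mk.inj hc
  obtain ⟨hd₁, hd₂⟩ := Prod.mk.inj hd
  have hcd : c = d := hc₁.symm.trans hd₁
  subst hcd
  have hqv := wordCoeff_q_ne_zero (fun i => abs_pos.1 (hq i).1) v
  refine Prod.ext rfl (mul_left_cancel₀ hqv ?_)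
  simp only [Aff2.toFun] at hc₂ hd₂ ⊢
  linarith
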